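/- arXiv:1807.08594 — 5 statements merged into one kernel-verified Lean document; each statement's English description precedes it below -/
import Mathlib

section
/- Let Y_{ab} be a Yano tensor of rank two on U and let X^m be a smooth vector field on U such that ∇_cY_{ab} = ε_{abcm}X^m. Then the Hodge dual (⋆Y)^{ab} := (1/2)ε^{abmn}Y_{mn} (indices of ε raised with g) satisfies ∇_c(⋆Y)^{ab} = X^a δ^b_c − X^b δ^a_c, where δ is the Kronecker delta. -/
/-!
STATEMENT 1: If `Y` is a Yano tensor with `∇_cY_{ab} = ε_{abcm}X^m`, then the
Hodge dual `(⋆Y)^{ab} := (1/2)ε^{abmn}Y_{mn}` satisfies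
`∇_c(⋆Y)^{ab} = X^a δ^b_c − X^b δ^a_c`.
-/

noncomputable section

abbrev Pt : Type := Fin 4 → ℝ

/-- Partial derivative of a scalar field in the `c`-th coordinate direction. -/
def pd (f : Pt → ℝ) (c : Fin 4) (p : Pt) : ℝ := fderiv ℝ f p (Pi.single c 1)

/-- Covariant derivative `∇_c X_a` of a covector field. -/
def covVec (Γ : Fin 4 → Fin 4 → Fin 4 → Pt → ℝ) (X : Fin 4 → Pt → ℝ)
    (c a : Fin 4) (p : Pt) : ℝ :=
  pd (X a) c p - ∑ m, Γ m c a p * X m p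

/-- Covariant derivative `∇_c Y_{ab}` of a (0,2)-tensor field. -/
def cov2 (Γ : Fin 4 → Fin 4 → Fin 4 → Pt → ℝ) (Y : Fin 4 → Fin 4 → Pt → ℝ)
    (c a b : Fin 4) (p : Pt) : ℝ :=
  pd (Y a b) c p - ∑ m, Γ m c a p * Y m b p - ∑ m, Γ m c b p * Y a m p

/-- Sign of `(a,b,c,d)` as a permutation of `(0,1,2,3)`; `0` if indices repeat. -/
def sgn4 (a b c d : Fin 4) : ℝ :=
  let v : Fin 4 → ℝ := ![(a.1 : ℝ), (b.1 : ℝ), (c.1 : ℝ), (d.1 : ℝ)]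
  ∏ i : Fin 4, ∏ j : Fin 4, if i < j then (v j - v i) / ((j.1 : ℝ) - (i.1 : ℝ)) else 1

/-- The volume tensor `ε_{abcd} = √(−det g)·sgn(abcd)`. -/
def eps (g : Fin 4 → Fin 4 → Pt → ℝ) (a b c d : Fin 4) (p : Pt) : ℝ :=
  Real.sqrt (-(Matrix.det (Matrix.of fun i j => g i j p))) * sgn4 a b c d

/-- Covariant derivative `∇_c S^{ab}` of a (2,0)-tensor field. -/
def cov2up (Γ : Fin 4 → Fin 4 → Fin 4 → Pt → ℝ) (S : Fin 4 → Fin 4 → Pt → ℝ)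
    (c a b : Fin 4) (p : Pt) : ℝ :=
  pd (S a b) c p + ∑ m, Γ a c m p * S m b p + ∑ m, Γ b c m p * S a m p

/-- `ε^{abcd}`: the volume tensor with all indices raised by `g`. -/
def epsUp (g ginv : Fin 4 → Fin 4 → Pt → ℝ) (a b c d : Fin 4) (p : Pt) : ℝ :=
  ∑ a', ∑ b', ∑ c', ∑ d',
    ginv a a' p * ginv b b' p * ginv c c' p * ginv d d' p * eps g a' b' c' d' p

/-- The Hodge dual `(⋆Y)^{ab} = (1/2) ε^{abmn} Y_{mn}`. -/
def starYup (g ginv Y : Fin 4 → Fin 4 → Pt → ℝ) (a b : Fin 4) (p : Pt) : ℝ :=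
  (1 / 2) * ∑ m, ∑ n, epsUp g ginv a b m n p * Y m n p

/-- A first-order form of Jacobi's formula: replacing the rows of `A` one at a time by those of `B`
and adding up the determinants gives the trace of `adjugate A * B`. -/
theorem sum_det_updateRow {n : Type*} [Fintype n] [DecidableEq n] (A B : Matrix n n ℝ) :
    ∑ i, (A.updateRow i (B i)).det = (A.adjugate * B).trace := by
  rw [Matrix.trace_mul_comm]
  simp only [Matrix.trace, Matrix.diag_apply, Matrix.mul_apply]
  refine Finset.sum_congr rfl fun i _ => ?_
  rw [← Matrix.cramer_transpose_apply, Matrix.cramer_eq_adjugate_mulVec,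
    ← Matrix.adjugate_transpose]
  simp [Matrix.mulVec, dotProduct, mul_comm]

theorem sum_det_updateRow_mul_right {n : Type*} [Fintype n] [DecidableEq n] (A M : Matrix n n ℝ) :
    ∑ i, (A.updateRow i ((A * M) i)).det = M.trace * A.det := by
  rw [sum_det_updateRow, ← Matrix.mul_assoc, Matrix.adjugate_mul]
  simp [mul_comm]

theorem sum_det_updateRow_mul_left {n : Type*} [Fintype n] [DecidableEq n] (A M : Matrix n n ℝ) :
    ∑ i, (A.updateRow i ((M * A) i)).det = M.trace * A.det := by
  rw [sum_det_updateRow, Matrix.trace_mul_comm, Matrix.mul_assoc, Matrix.mul_adjugate]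
  simp [mul_comm]

theorem hasFDerivAt_det {n E : Type*} [Fintype n] [DecidableEq n] [NormedAddCommGroup E]
    [NormedSpace ℝ E] {G : E → Matrix n n ℝ} {G' : n → n → E →L[ℝ] ℝ} {p : E}
    (hG : ∀ i j, HasFDerivAt (fun q => G q i j) (G' i j) p) :
    ∃ D : E →L[ℝ] ℝ, HasFDerivAt (fun q => (G q).det) D p ∧
      ∀ v, D v = ∑ i, ((G p).updateRow i (fun j => G' i j v)).det := by
  let f : ContinuousMultilinearMap ℝ (fun _ : n => n → ℝ) ℝ :=
    { Matrix.detRowAlternating.toMultilinearMap with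
      cont := Continuous.matrix_det (A := fun x : n → n → ℝ => Matrix.of x) continuous_id }
  have h := HasFDerivAt.multilinear_comp f (g := fun i q => G q i)
    (g' := fun i => ContinuousLinearMap.pi (G' i)) (x := p)
    (fun i => hasFDerivAt_pi.2 (hG i))
  refine ⟨_, h, fun v => ?_⟩
  simp only [sum_apply, ContinuousLinearMap.comp_apply]
  rfl

theorem sum_mul_sgn4 (x y z w : Fin 4 → ℝ) :
    ∑ a, ∑ b, ∑ c, ∑ d, x a * y b * z c * w d * sgn4 a b c d =
      (Matrix.of ![x, y, z, w]).det := by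
  simp [sgn4, Fin.prod_univ_four, Matrix.det_succ_row_zero, Fin.sum_univ_succ,
    Fin.succAbove]
  ring

theorem sgn4_eq_det (a b c d : Fin 4) :
    sgn4 a b c d =
      (Matrix.of ![Pi.single a 1, Pi.single b 1, Pi.single c 1, Pi.single d (1 : ℝ)]).det := by
  rw [← sum_mul_sgn4]
  simp [Pi.single_apply]

theorem sum_matrix_mul_sgn4 (M : Matrix (Fin 4) (Fin 4) ℝ) (a b c d : Fin 4) :
    ∑ a', ∑ b', ∑ c', ∑ d', M a a' * M b b' * M c c' * M d d' * sgn4 a' b' c' d' =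
      M.det * sgn4 a b c d := by
  rw [sum_mul_sgn4, sgn4_eq_det, mul_comm, ← Matrix.det_mul]
  congr 1
  ext i j
  fin_cases i <;> simp [Matrix.mul_apply, Pi.single_apply]

/-- The sign symbol is an invariant density: the infinitesimal action of `A` scales it by
the trace. -/
theorem sum_infinitesimal_sgn4 (A : Matrix (Fin 4) (Fin 4) ℝ) (a b c d : Fin 4) :
    ∑ k, A a k * sgn4 k b c d + ∑ k, A b k * sgn4 a k c d + ∑ k, A c k * sgn4 a b k d +
      ∑ k, A d k * sgn4 a b c k = A.trace * sgn4 a b c d := by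
  have ha : ∑ k, A a k * sgn4 k b c d = (Matrix.of
      ![A a, Pi.single b 1, Pi.single c 1, Pi.single d (1 : ℝ)]).det := by
    rw [← sum_mul_sgn4]; simp [Pi.single_apply]
  have hb : ∑ k, A b k * sgn4 a k c d = (Matrix.of
      ![Pi.single a 1, A b, Pi.single c 1, Pi.single d (1 : ℝ)]).det := by
    rw [← sum_mul_sgn4]; simp [Pi.single_apply]
  have hc : ∑ k, A c k * sgn4 a b k d = (Matrix.of
      ![Pi.single a 1, Pi.single b 1, A c, Pi.single d (1 : ℝ)]).det := by
    rw [← sum_mul_sgn4]; simp [Pi.single_apply]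
  have hd : ∑ k, A d k * sgn4 a b c k = (Matrix.of
      ![Pi.single a 1, Pi.single b 1, Pi.single c (1 : ℝ), A d]).det := by
    rw [← sum_mul_sgn4]; simp [Pi.single_apply]
  rw [ha, hb, hc, hd, sgn4_eq_det a b c d, ← sum_det_updateRow_mul_right, Fin.sum_univ_four]
  congr 1
  · congr 1
    · congr 1 <;>
      · congr 1
        ext i j
        fin_cases i <;> simp [Matrix.updateRow_apply, Pi.single_apply]
    · congr 1
      ext i j
      fin_cases i <;> simp [Matrix.updateRow_apply, Pi.single_apply]
  · congr 1
    ext i j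
    fin_cases i <;> simp [Matrix.updateRow_apply, Pi.single_apply]

/-- The Vandermonde product of four indices. -/
def vandermonde4 (a b c d : Fin 4) : ℤ :=
  (b.1 - a.1) * (c.1 - a.1) * (d.1 - a.1) * (c.1 - b.1) * (d.1 - b.1) * (d.1 - c.1)

theorem sgn4_eq_vandermonde4 (a b c d : Fin 4) :
    sgn4 a b c d = (vandermonde4 a b c d : ℝ) / 12 := by
  simp [sgn4, vandermonde4, Fin.prod_univ_four]
  ring

set_option maxRecDepth 20000 in
theorem vandermonde4_contract : ∀ a b c d : Fin 4,
    ∑ m, ∑ n, vandermonde4 a b m n * vandermonde4 m n c d =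
      288 * ((if a = c then 1 else 0) * (if b = d then 1 else 0) -
        (if a = d then 1 else 0) * (if b = c then 1 else 0)) := by
  decide

theorem sgn4_contract (a b c d : Fin 4) :
    ∑ m, ∑ n, sgn4 a b m n * sgn4 m n c d =
      2 * ((if a = c then 1 else 0) * (if b = d then 1 else 0) -
        (if a = d then 1 else 0) * (if b = c then 1 else 0)) := by
  have h := congrArg (Int.cast : ℤ → ℝ) (vandermonde4_contract a b c d)
  push_cast at h
  have h' : ∑ m, ∑ n, sgn4 a b m n * sgn4 m n c d =
      (∑ m, ∑ n, (vandermonde4 a b m n : ℝ) * vandermonde4 m n c d) / 144 := by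
    simp only [sgn4_eq_vandermonde4, Finset.sum_div]
    refine Finset.sum_congr rfl fun m _ => Finset.sum_congr rfl fun n _ => ?_
    ring
  rw [h', h]
  ring

theorem epsUp_eq {g ginv : Fin 4 → Fin 4 → Pt → ℝ} {p : Pt}
    (hdet : Matrix.det (Matrix.of fun i j => g i j p) < 0)
    (hinv : ∀ a b, (∑ m, g a m p * ginv m b p) = if a = b then 1 else 0) (a b c d : Fin 4) :
    epsUp g ginv a b c d p =
      -(Real.sqrt (-(Matrix.det (Matrix.of fun i j => g i j p))))⁻¹ * sgn4 a b c d := by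
  have hmul : (Matrix.of fun i j => g i j p) * (Matrix.of fun i j => ginv i j p) = 1 := by
    ext i j
    simpa [Matrix.mul_apply, Matrix.one_apply] using hinv i j
  have hdd := congrArg Matrix.det hmul
  rw [Matrix.det_mul, Matrix.det_one] at hdd
  have hs := sum_matrix_mul_sgn4 (Matrix.of fun i j => ginv i j p) a b c d
  simp only [Matrix.of_apply] at hs
  have hfac : epsUp g ginv a b c d p =
      Real.sqrt (-(Matrix.det (Matrix.of fun i j => g i j p))) *
        ∑ a', ∑ b', ∑ c', ∑ d', ginv a a' p * ginv b b' p * ginv c c' p * ginv d d' p *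
          sgn4 a' b' c' d' := by
    simp only [epsUp, eps, Finset.mul_sum]
    refine Finset.sum_congr rfl fun _ _ => Finset.sum_congr rfl fun _ _ =>
      Finset.sum_congr rfl fun _ _ => Finset.sum_congr rfl fun _ _ => ?_
    ring
  rw [hfac, hs, ← mul_assoc]
  congr 1
  have hpos : 0 < Real.sqrt (-(Matrix.det (Matrix.of fun i j => g i j p))) :=
    Real.sqrt_pos.2 (by linarith)
  have hsq := Real.mul_self_sqrt
    (show 0 ≤ -(Matrix.det (Matrix.of fun i j => g i j p)) by linarith)
  generalize Real.sqrt (-(Matrix.det (Matrix.of fun i j => g i j p))) = s at *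
  rw [eq_neg_iff_add_eq_zero, ← mul_right_inj' hpos.ne', mul_add, mul_inv_cancel₀ hpos.ne']
  linear_combination (Matrix.of fun i j => ginv i j p).det * hsq - hdd

/-- The derivative of the metric determinant along a coordinate direction is controlled by the
trace of the connection. -/
theorem hasFDerivAt_det_of_compat {Γ : Fin 4 → Fin 4 → Fin 4 → Pt → ℝ}
    {g : Fin 4 → Fin 4 → Pt → ℝ} {p : Pt} (hg : ∀ a b, DifferentiableAt ℝ (g a b) p)
    (hcompat : ∀ c a b, cov2 Γ g c a b p = 0) :
    ∃ D : Pt →L[ℝ] ℝ, HasFDerivAt (fun q => Matrix.det (Matrix.of fun i j => g i j q)) D p ∧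
      ∀ c, D (Pi.single c 1) =
        2 * (∑ m, Γ m c m p) * Matrix.det (Matrix.of fun i j => g i j p) := by
  obtain ⟨D, hD, hDv⟩ := hasFDerivAt_det (G := fun q => Matrix.of fun i j => g i j q)
    (G' := fun i j => fderiv ℝ (g i j) p) (p := p) fun i j => (hg i j).hasFDerivAt
  refine ⟨D, hD, fun c => ?_⟩
  set G : Matrix (Fin 4) (Fin 4) ℝ := Matrix.of fun i j => g i j p with hG
  let A : Matrix (Fin 4) (Fin 4) ℝ := Matrix.of fun m a => Γ m c a p
  have hrow (i : Fin 4) : (fun j => fderiv ℝ (g i j) p (Pi.single c 1)) =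
      (A.transpose * G) i + (G * A) i := by
    ext j
    have h := hcompat c i j
    simp only [cov2, pd] at h
    simp only [Pi.add_apply, Matrix.mul_apply, Matrix.transpose_apply, A, hG, Matrix.of_apply]
    simp only [mul_comm (g i _ p)]
    linarith
  rw [hDv]
  simp only [hrow, Matrix.det_updateRow_add, Finset.sum_add_distrib,
    sum_det_updateRow_mul_right, sum_det_updateRow_mul_left, Matrix.trace_transpose]
  simp only [Matrix.trace, Matrix.diag_apply, A, Matrix.of_apply]
  ring

/-- The tensor algebra behind the theorem, at one point and in one direction: `A` holds the
connection coefficients, `dY` the partial derivatives of `Y`. -/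
theorem sgn4_dual_derivative (A Y dY : Matrix (Fin 4) (Fin 4) ℝ) (X : Fin 4 → ℝ) (s : ℝ)
    (c : Fin 4)
    (hY : ∀ a b, dY a b - ∑ m, A m a * Y m b - ∑ m, A m b * Y a m =
      ∑ m, s * sgn4 a b c m * X m) (a b : Fin 4) :
    ∑ m, ∑ n, sgn4 a b m n * (dY m n - A.trace * Y m n) +
        ∑ k, A a k * ∑ m, ∑ n, sgn4 k b m n * Y m n +
        ∑ k, A b k * ∑ m, ∑ n, sgn4 a k m n * Y m n =
      2 * s * (X b * (if a = c then 1 else 0) - X a * (if b = c then 1 else 0)) := by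
  have hX : ∑ m, ∑ n, sgn4 a b m n * ∑ l, s * sgn4 m n c l * X l =
      2 * s * (X b * (if a = c then 1 else 0) - X a * (if b = c then 1 else 0)) := by
    calc ∑ m, ∑ n, sgn4 a b m n * ∑ l, s * sgn4 m n c l * X l
        = ∑ l, s * X l * ∑ m, ∑ n, sgn4 a b m n * sgn4 m n c l := by
          simp only [Fin.sum_univ_four]
          ring
      _ = ∑ l, (2 * s * (if a = c then 1 else 0) * (if b = l then X l else 0) -
            2 * s * (if b = c then 1 else 0) * (if a = l then X l else 0)) := by
          refine Finset.sum_congr rfl fun l _ => ?_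
          rw [sgn4_contract, ← mul_boole (b = l) (X l), ← mul_boole (a = l) (X l)]
          ring
      _ = _ := by
          rw [Finset.sum_sub_distrib, ← Finset.mul_sum, ← Finset.mul_sum]
          simp only [Finset.sum_ite_eq, Finset.mem_univ, if_true]
          ring
  have hdY : ∑ m, ∑ n, sgn4 a b m n * (dY m n - ∑ k, A k m * Y k n - ∑ k, A k n * Y m k) =
      ∑ m, ∑ n, sgn4 a b m n * ∑ l, s * sgn4 m n c l * X l := by
    simp only [hY]
  have hA : ∑ m, ∑ n, Y m n * (∑ k, A a k * sgn4 k b m n + ∑ k, A b k * sgn4 a k m n +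
      ∑ k, A m k * sgn4 a b k n + ∑ k, A n k * sgn4 a b m k) =
      ∑ m, ∑ n, Y m n * (A.trace * sgn4 a b m n) := by
    simp only [sum_infinitesimal_sgn4]
  rw [← hX, ← hdY]
  generalize A.trace = T at *
  simp only [Fin.sum_univ_four] at hA ⊢
  linear_combination hA

theorem hodge_dual_yano_derivative
    (U : Set Pt) (hU : IsOpen U)
    (Γ : Fin 4 → Fin 4 → Fin 4 → Pt → ℝ)
    (hΓsmooth : ∀ m a b, ContDiffOn ℝ (⊤ : ℕ∞) (Γ m a b) U)
    (hΓsymm : ∀ m a b, ∀ p ∈ U, Γ m a b p = Γ m b a p)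
    (g ginv : Fin 4 → Fin 4 → Pt → ℝ)
    (hgsmooth : ∀ a b, ContDiffOn ℝ (⊤ : ℕ∞) (g a b) U)
    (hgsymm : ∀ a b, ∀ p ∈ U, g a b p = g b a p)
    (hgdet : ∀ p ∈ U, Matrix.det (Matrix.of fun i j => g i j p) < 0)
    (hginv : ∀ p ∈ U, ∀ a b, (∑ m, g a m p * ginv m b p) = if a = b then 1 else 0)
    (hcompat : ∀ p ∈ U, ∀ c a b, cov2 Γ g c a b p = 0)
    (Y : Fin 4 → Fin 4 → Pt → ℝ)
    (hYsmooth : ∀ a b, ContDiffOn ℝ (⊤ : ℕ∞) (Y a b) U)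
    (hYanti : ∀ a b, ∀ p ∈ U, Y a b p = - Y b a p)
    (hYano : ∀ a b c, ∀ p ∈ U, cov2 Γ Y c b a p + cov2 Γ Y b c a p = 0)
    (X : Fin 4 → Pt → ℝ)
    (hXsmooth : ∀ a, ContDiffOn ℝ (⊤ : ℕ∞) (X a) U)
    (hYX : ∀ p ∈ U, ∀ a b c, cov2 Γ Y c a b p = ∑ m, eps g a b c m p * X m p) :
    ∀ p ∈ U, ∀ a b c,
      cov2up Γ (starYup g ginv Y) c a b p =
        X a p * (if b = c then 1 else 0) - X b p * (if a = c then 1 else 0) := by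
  intro p hp a b c
  have hU' : U ∈ nhds p := hU.mem_nhds hp
  have hdiff {f : Pt → ℝ} (hf : ContDiffOn ℝ (⊤ : ℕ∞) f U) : DifferentiableAt ℝ f p :=
    (hf.contDiffAt hU').differentiableAt (by simp)
  obtain ⟨D, hD, hDc⟩ := hasFDerivAt_det_of_compat (fun a b => hdiff (hgsmooth a b))
    (hcompat p hp)
  have hneg := hgdet p hp
  let s : Pt → ℝ := fun q => Real.sqrt (-(Matrix.det (Matrix.of fun i j => g i j q)))
  have hspos : 0 < s p := Real.sqrt_pos.2 (by linarith)
  have hsq : s p * s p = -(Matrix.det (Matrix.of fun i j => g i j p)) :=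
    Real.mul_self_sqrt (by linarith)
  have hstar (a b : Fin 4) {q : Pt} (hq : q ∈ U) : starYup g ginv Y a b q =
      -(1 / 2) * (s q)⁻¹ * ∑ m, ∑ n, sgn4 a b m n * Y m n q := by
    simp only [starYup, epsUp_eq (hgdet q hq) (hginv q hq), Finset.mul_sum, s]
    refine Finset.sum_congr rfl fun _ _ => Finset.sum_congr rfl fun _ _ => ?_
    ring
  have hs : HasFDerivAt s ((1 / (2 * s p)) • -D) p := hD.neg.sqrt (neg_pos.2 hneg).ne'
  have hinv : HasFDerivAt (fun q => (s q)⁻¹) (-(s p ^ 2)⁻¹ • (1 / (2 * s p)) • -D) p :=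
    (hasDerivAt_inv hspos.ne').comp_hasFDerivAt p hs
  have hinvc : (-(s p ^ 2)⁻¹ • (1 / (2 * s p)) • -D) (Pi.single c 1) =
      -(∑ m, Γ m c m p) * (s p)⁻¹ := by
    have hdet : Matrix.det (Matrix.of fun i j => g i j p) = -(s p * s p) := by linarith
    simp only [smul_apply, neg_apply, smul_eq_mul, hDc, hdet]
    field_simp
  generalize -(s p ^ 2)⁻¹ • (1 / (2 * s p)) • -D = S at hinv hinvc
  have hsum : HasFDerivAt (fun q => ∑ m, ∑ n, sgn4 a b m n * Y m n q)
      (∑ m, ∑ n, sgn4 a b m n • fderiv ℝ (Y m n) p) p :=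
    HasFDerivAt.fun_sum fun m _ => HasFDerivAt.fun_sum fun n _ =>
      (hdiff (hYsmooth m n)).hasFDerivAt.const_mul _
  have hpd : pd (starYup g ginv Y a b) c p = -(1 / 2) * (s p)⁻¹ *
      ∑ m, ∑ n, sgn4 a b m n * (pd (Y m n) c p - (∑ m, Γ m c m p) * Y m n p) := by
    have hev : starYup g ginv Y a b =ᶠ[nhds p] fun q =>
        -(1 / 2) * (s q)⁻¹ * ∑ m, ∑ n, sgn4 a b m n * Y m n q := by
      filter_upwards [hU'] with q hq using hstar a b hq
    rw [pd, hev.fderiv_eq, ((hinv.const_mul (-(1 / 2))).fun_mul hsum).fderiv]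
    simp only [add_apply, smul_apply, sum_apply, smul_eq_mul, hinvc, pd, mul_sub,
      Finset.sum_sub_distrib, mul_left_comm _ (∑ m, Γ m c m p), ← Finset.mul_sum]
    ring
  have key := sgn4_dual_derivative (Matrix.of fun m a => Γ m c a p) (Matrix.of fun a b => Y a b p)
    (Matrix.of fun a b => pd (Y a b) c p) (fun m => X m p) (s p) c
    (fun a b => hYX p hp a b c) a b
  simp only [Matrix.trace, Matrix.diag_apply, Matrix.of_apply] at key
  have hfac (f h : Fin 4 → ℝ) (t : ℝ) : ∑ m, f m * (t * h m) = t * ∑ m, f m * h m := by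
    rw [Finset.mul_sum]
    exact Finset.sum_congr rfl fun _ _ => by ring
  rw [cov2up, hpd]
  simp only [hstar _ _ hp, hfac]
  rw [← mul_add, ← mul_add, key]
  field_simp
  ring
end
end

section
/- Let Y_{ab} be a Yano tensor of rank two on U and let X^m be a smooth vector field on U such that ∇_cY_{ab} = ε_{abcm}X^m. Then X is divergence-free: ∇_aX^a := ∂_aX^a + Γ^a_{am}X^m = 0 on U. -/
/-!
STATEMENT 2: If `Y` is a Yano tensor with `∇_cY_{ab} = ε_{abcm}X^m`, then `X`
is divergence-free: `∇_aX^a = ∂_aX^a + Γ^a_{am}X^m = 0` on `U`.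
-/

noncomputable section

open Filter Topology

/-- Jacobi's formula for the derivative of the determinant along a curve of matrices. -/
theorem hasDerivAt_matrix_det {n : Type*} [Fintype n] [DecidableEq n]
    {M : ℝ → Matrix n n ℝ} {M' : Matrix n n ℝ} {t : ℝ}
    (hM : ∀ i j, HasDerivAt (fun s => M s i j) (M' i j) t) :
    HasDerivAt (fun s => (M s).det) (((M t).adjugate * M').trace) t := by
  have htrace : ((M t).adjugate * M').trace = ∑ i, ((M t).updateCol i (M'.col i)).det := by
    simp only [Matrix.trace, Matrix.diag_apply, ← Matrix.cramer_apply,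
      Matrix.cramer_eq_adjugate_mulVec]
    rfl
  have hcol : ∀ i, ((M t).updateCol i (M'.col i)).det = ∑ σ : Equiv.Perm n,
      ((Equiv.Perm.sign σ : ℤ) : ℝ) *
        ((∏ j ∈ Finset.univ.erase i, M t (σ j) j) * M' (σ i) i) := by
    intro i
    rw [Matrix.det_apply']
    refine Finset.sum_congr rfl fun σ _ => ?_
    rw [← Finset.prod_erase_mul _ _ (Finset.mem_univ i), Matrix.updateCol_self, Matrix.col_apply]
    congr 2
    exact Finset.prod_congr rfl fun j hj => Matrix.updateCol_ne (Finset.ne_of_mem_erase hj)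
  rw [htrace, Finset.sum_congr rfl fun i _ => hcol i, Finset.sum_comm]
  simp only [Matrix.det_apply']
  refine HasDerivAt.fun_sum fun σ _ => ?_
  rw [← Finset.mul_sum]
  refine HasDerivAt.const_mul _ ?_
  simpa only [smul_eq_mul] using
    HasDerivAt.fun_finsetProd (u := Finset.univ) fun i _ => hM (σ i) i

theorem hasDerivAt_line_pd {f : Pt → ℝ} {p : Pt} (hf : DifferentiableAt ℝ f p) (c : Fin 4) :
    HasDerivAt (fun t : ℝ => f (p + t • Pi.single c 1)) (pd f c p) 0 :=
  hf.hasFDerivAt.hasLineDerivAt _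

theorem pd_eq_of_hasDerivAt_line {f : Pt → ℝ} {p : Pt} (hf : DifferentiableAt ℝ f p)
    {c : Fin 4} {d : ℝ} (h : HasDerivAt (fun t : ℝ => f (p + t • Pi.single c 1)) d 0) :
    pd f c p = d :=
  (hasDerivAt_line_pd hf c).unique h

theorem pd_congr {f h : Pt → ℝ} {p : Pt} (hfh : f =ᶠ[𝓝 p] h) (c : Fin 4) :
    pd f c p = pd h c p := by
  rw [pd, pd, hfh.fderiv_eq]

theorem differentiableAt_pd {f : Pt → ℝ} {p : Pt} (hf : ContDiffAt ℝ 2 f p) (c : Fin 4) :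
    DifferentiableAt ℝ (pd f c) p :=
  ((hf.fderiv_right (m := 1) one_add_one_eq_two.le).differentiableAt
    one_ne_zero).clm_apply (differentiableAt_const _)

theorem pd_pd_comm {f : Pt → ℝ} {p : Pt} (hf : ContDiffAt ℝ 2 f p) (c d : Fin 4) :
    pd (pd f c) d p = pd (pd f d) c p := by
  have hd : DifferentiableAt ℝ (fderiv ℝ f) p :=
    (hf.fderiv_right (m := 1) one_add_one_eq_two.le).differentiableAt one_ne_zero
  have key : ∀ a b : Fin 4, pd (pd f a) b p =
      fderiv ℝ (fderiv ℝ f) p (Pi.single b 1) (Pi.single a 1) := by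
    intro a b
    change fderiv ℝ (fun q => fderiv ℝ f q (Pi.single a 1)) p (Pi.single b 1) = _
    rw [fderiv_clm_apply hd (differentiableAt_const _)]
    simp
  rw [key, key]
  exact hf.isSymmSndFDerivAt (by simp) _ _

theorem pd_cyclic_sub {f₁ f₂ f₃ : Pt → ℝ} {p : Pt} (h₁ : DifferentiableAt ℝ f₁ p)
    (h₂ : DifferentiableAt ℝ f₂ p) (h₃ : DifferentiableAt ℝ f₃ p) (c : Fin 4) :
    pd (fun q => f₁ q + f₂ q - f₃ q) c p = pd f₁ c p + pd f₂ c p - pd f₃ c p := by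
  simp only [pd]
  rw [fderiv_fun_sub (h₁.fun_add h₂) h₃, fderiv_fun_add h₁ h₂]
  rfl

theorem pd_neg (f : Pt → ℝ) (c : Fin 4) (p : Pt) : pd (fun q => -f q) c p = -pd f c p := by
  simp only [pd, fderiv_fun_neg]
  rfl

theorem pd_const_mul_mul (k : ℝ) {f h : Pt → ℝ} {p : Pt} (hf : DifferentiableAt ℝ f p)
    (hh : DifferentiableAt ℝ h p) (c : Fin 4) :
    pd (fun q => k * (f q * h q)) c p = k * (f p * pd h c p + h p * pd f c p) := by
  simp only [pd]
  rw [fderiv_const_mul (hf.fun_mul hh), fderiv_fun_mul hf hh]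
  rfl

theorem differentiableAt_det {g : Fin 4 → Fin 4 → Pt → ℝ} {p : Pt}
    (hg : ∀ a b, DifferentiableAt ℝ (g a b) p) :
    DifferentiableAt ℝ (fun q => Matrix.det (Matrix.of fun i j => g i j q)) p := by
  simp only [Matrix.det_apply', Matrix.of_apply]
  fun_prop

/-- For a compatible connection, `∂_c det g = 2 Γ^m_{cm} det g`. -/
theorem pd_det_of_cov2_eq_zero {Γ : Fin 4 → Fin 4 → Fin 4 → Pt → ℝ}
    {g : Fin 4 → Fin 4 → Pt → ℝ} {p : Pt} (hg : ∀ a b, DifferentiableAt ℝ (g a b) p)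
    {c : Fin 4} (hcompat : ∀ a b, cov2 Γ g c a b p = 0) :
    pd (fun q => Matrix.det (Matrix.of fun i j => g i j q)) c p =
      2 * (∑ m, Γ m c m p) * Matrix.det (Matrix.of fun i j => g i j p) := by
  set G : Matrix (Fin 4) (Fin 4) ℝ := Matrix.of fun i j => g i j p with hG
  set A : Matrix (Fin 4) (Fin 4) ℝ := Matrix.of fun a m => Γ m c a p with hA
  have hentry : ∀ a b, pd (g a b) c p = (A * G + G * A.transpose) a b := by
    intro a b
    have h := hcompat a b
    have hcomm : ∑ m, g a m p * Γ m c b p = ∑ m, Γ m c b p * g a m p :=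
      Finset.sum_congr rfl fun m _ => mul_comm _ _
    simp only [cov2] at h
    simp only [hA, hG, Matrix.add_apply, Matrix.mul_apply, Matrix.transpose_apply,
      Matrix.of_apply, hcomm]
    linarith
  have hJ := hasDerivAt_matrix_det (t := 0)
    (M := fun t : ℝ => Matrix.of fun i j => g i j (p + t • Pi.single c 1))
    (M' := A * G + G * A.transpose)
    fun a b => hentry a b ▸ hasDerivAt_line_pd (hg a b) c
  rw [pd_eq_of_hasDerivAt_line (differentiableAt_det hg) hJ]
  have htr : A.trace = ∑ m, Γ m c m p := rfl
  simp only [zero_smul, add_zero]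
  rw [← hG, mul_add, Matrix.trace_add, ← mul_assoc, Matrix.trace_mul_comm, ← mul_assoc,
    Matrix.mul_adjugate, ← mul_assoc, Matrix.adjugate_mul, smul_mul_assoc, smul_mul_assoc,
    one_mul, one_mul, Matrix.trace_smul, Matrix.trace_smul, Matrix.trace_transpose, htr,
    smul_eq_mul]
  ring

/-- For a compatible connection, `∂_c √(−det g) = Γ^m_{cm} √(−det g)`. -/
theorem pd_sqrt_neg_det {Γ : Fin 4 → Fin 4 → Fin 4 → Pt → ℝ}
    {g : Fin 4 → Fin 4 → Pt → ℝ} {p : Pt} (hg : ∀ a b, DifferentiableAt ℝ (g a b) p)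
    (hdet : Matrix.det (Matrix.of fun i j => g i j p) < 0)
    {c : Fin 4} (hcompat : ∀ a b, cov2 Γ g c a b p = 0) :
    pd (fun q => Real.sqrt (-Matrix.det (Matrix.of fun i j => g i j q))) c p =
      (∑ m, Γ m c m p) * Real.sqrt (-Matrix.det (Matrix.of fun i j => g i j p)) := by
  have hpd := pd_det_of_cov2_eq_zero hg hcompat
  have hpos := Real.sqrt_pos.2 (neg_pos.2 hdet)
  have hsq := Real.sq_sqrt (neg_pos.2 hdet).le
  have hd := (differentiableAt_det hg).fun_neg
  have h : pd (fun q => Real.sqrt (-Matrix.det (Matrix.of fun i j => g i j q))) c p =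
      1 / (2 * Real.sqrt (-Matrix.det (Matrix.of fun i j => g i j p))) *
        pd (fun q => -Matrix.det (Matrix.of fun i j => g i j q)) c p := by
    simp only [pd]
    rw [fderiv_sqrt hd (neg_pos.2 hdet).ne']
    rfl
  rw [h, pd_neg, hpd]
  field_simp
  rw [hsq]
  ring

/-- The cyclic sum of `∇Y` is the exterior derivative of `Y` when the connection is symmetric. -/
theorem cov2_cyclic_sum {Γ : Fin 4 → Fin 4 → Fin 4 → Pt → ℝ} {Y : Fin 4 → Fin 4 → Pt → ℝ}
    {p : Pt} (hΓ : ∀ m a b, Γ m a b p = Γ m b a p) (hY : ∀ᶠ q in 𝓝 p, ∀ a b, Y a b q = -Y b a q)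
    (a b c : Fin 4) :
    cov2 Γ Y c a b p + cov2 Γ Y a b c p + cov2 Γ Y b c a p =
      pd (Y a b) c p + pd (Y b c) a p - pd (Y a c) b p := by
  have hca : pd (Y c a) b p = -pd (Y a c) b p := by
    rw [← pd_neg]
    exact pd_congr (hY.mono fun q hq => hq c a) b
  have hflip : ∀ i j k, ∑ m, Γ m i j p * Y m k p = -∑ m, Γ m j i p * Y k m p := by
    intro i j k
    rw [← Finset.sum_neg_distrib]
    refine Finset.sum_congr rfl fun m _ => ?_
    rw [hΓ m i j, hY.self_of_nhds m k, mul_neg]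
  simp only [cov2, hca, hflip]
  ring

theorem eps_perm_cyclic (g : Fin 4 → Fin 4 → Pt → ℝ) (a b c m : Fin 4) (p : Pt) :
    eps g b c a m p = eps g a b c m p := by
  simp only [eps, sgn4, Fin.prod_univ_four]
  simp
  left
  ring

theorem yano_dual_vector_divergence_free
    (U : Set Pt) (hU : IsOpen U)
    (Γ : Fin 4 → Fin 4 → Fin 4 → Pt → ℝ)
    (hΓsmooth : ∀ m a b, ContDiffOn ℝ (⊤ : ℕ∞) (Γ m a b) U)
    (hΓsymm : ∀ m a b, ∀ p ∈ U, Γ m a b p = Γ m b a p)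
    (g ginv : Fin 4 → Fin 4 → Pt → ℝ)
    (hgsmooth : ∀ a b, ContDiffOn ℝ (⊤ : ℕ∞) (g a b) U)
    (hgsymm : ∀ a b, ∀ p ∈ U, g a b p = g b a p)
    (hgdet : ∀ p ∈ U, Matrix.det (Matrix.of fun i j => g i j p) < 0)
    (hginv : ∀ p ∈ U, ∀ a b, (∑ m, g a m p * ginv m b p) = if a = b then 1 else 0)
    (hcompat : ∀ p ∈ U, ∀ c a b, cov2 Γ g c a b p = 0)
    (Y : Fin 4 → Fin 4 → Pt → ℝ)
    (hYsmooth : ∀ a b, ContDiffOn ℝ (⊤ : ℕ∞) (Y a b) U)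
    (hYanti : ∀ a b, ∀ p ∈ U, Y a b p = - Y b a p)
    (hYano : ∀ a b c, ∀ p ∈ U, cov2 Γ Y c b a p + cov2 Γ Y b c a p = 0)
    (X : Fin 4 → Pt → ℝ)
    (hXsmooth : ∀ a, ContDiffOn ℝ (⊤ : ℕ∞) (X a) U)
    (hYX : ∀ p ∈ U, ∀ a b c, cov2 Γ Y c a b p = ∑ m, eps g a b c m p * X m p) :
    ∀ p ∈ U, (∑ a, pd (X a) a p) + (∑ a, ∑ m, Γ a a m p * X m p) = 0 := by
  have smoothAt : ∀ {f : Pt → ℝ}, ContDiffOn ℝ (⊤ : ℕ∞) f U → ∀ q ∈ U,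
      ContDiffAt ℝ (⊤ : ℕ∞) f q := fun hf q hq => hf.contDiffAt (hU.mem_nhds hq)
  set s : Pt → ℝ := fun q => Real.sqrt (-Matrix.det (Matrix.of fun i j => g i j q)) with hs
  have closed : ∀ a b c, ∀ q ∈ U, 3 * (s q * ∑ m, sgn4 a b c m * X m q) =
      pd (Y a b) c q + pd (Y b c) a q - pd (Y a c) b q := by
    intro a b c q hq
    have hY : ∀ᶠ r in 𝓝 q, ∀ a b, Y a b r = -Y b a r :=
      (hU.eventually_mem hq).mono fun r hr a b => hYanti a b r hr
    rw [← cov2_cyclic_sum (fun m a b => hΓsymm m a b q hq) hY, hYX q hq, hYX q hq, hYX q hq]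
    simp only [eps_perm_cyclic g a b c, ← eps_perm_cyclic g c a b]
    simp only [eps, Finset.mul_sum, ← Finset.sum_add_distrib]
    refine Finset.sum_congr rfl fun m _ => ?_
    simp only [hs]
    ring
  intro p hp
  have hsd : DifferentiableAt ℝ s p :=
    (differentiableAt_det fun a b => (smoothAt (hgsmooth a b) p hp).differentiableAt
      (by simp)).fun_neg.sqrt (neg_pos.2 (hgdet p hp)).ne'
  have hXd : ∀ a, DifferentiableAt ℝ (X a) p :=
    fun a => (smoothAt (hXsmooth a) p hp).differentiableAt (by simp)
  have hspos : 0 < s p := Real.sqrt_pos.2 (neg_pos.2 (hgdet p hp))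
  have hpds : ∀ c, pd s c p = (∑ m, Γ m c m p) * s p := fun c =>
    pd_sqrt_neg_det (fun a b => (smoothAt (hgsmooth a b) p hp).differentiableAt (by simp))
      (hgdet p hp) (hcompat p hp c)
  have hYp : ∀ a b, ContDiffAt ℝ 2 (Y a b) p := fun a b =>
    (smoothAt (hYsmooth a b) p hp).of_le (WithTop.coe_le_coe.2 (le_top : (2 : ℕ∞) ≤ ⊤))
  have density : ∀ a b c d, ∀ k : ℝ, (∀ q, ∑ m, sgn4 a b c m * X m q = k * X d q) →
      3 * k * (s p * pd (X d) d p + X d p * ((∑ m, Γ m d m p) * s p)) =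
        pd (pd (Y a b) c) d p + pd (pd (Y b c) a) d p - pd (pd (Y a c) b) d p := by
    intro a b c d k hk
    rw [← hpds, ← pd_const_mul_mul _ hsd (hXd d),
      ← pd_cyclic_sub (differentiableAt_pd (hYp a b) c) (differentiableAt_pd (hYp b c) a)
        (differentiableAt_pd (hYp a c) b)]
    refine pd_congr ((hU.eventually_mem hp).mono fun q hq => ?_) d
    rw [← closed a b c q hq, hk]
    ring
  have h₀ := density 1 2 3 0 (-1) fun q => by
    simp [sgn4, Fin.prod_univ_four, Fin.sum_univ_four]; norm_num
  have h₁ := density 0 2 3 1 1 fun q => by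
    simp [sgn4, Fin.prod_univ_four, Fin.sum_univ_four]; norm_num
  have h₂ := density 0 1 3 2 (-1) fun q => by
    simp [sgn4, Fin.prod_univ_four, Fin.sum_univ_four]; norm_num
  have h₃ := density 0 1 2 3 1 fun q => by
    simp [sgn4, Fin.prod_univ_four, Fin.sum_univ_four]; norm_num
  have hcontract : ∑ a, ∑ m, Γ a a m p * X m p = ∑ d, X d p * ∑ m, Γ m d m p := by
    rw [Finset.sum_comm]
    refine Finset.sum_congr rfl fun d _ => ?_
    rw [Finset.mul_sum]
    exact Finset.sum_congr rfl fun m _ => by rw [hΓsymm m m d p hp, mul_comm]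
  rw [hcontract, ← Finset.sum_add_distrib, Fin.sum_univ_four]
  refine (mul_eq_zero.1 ?_).resolve_left hspos.ne'
  linarith [pd_pd_comm (hYp 0 1) 2 3, pd_pd_comm (hYp 0 2) 1 3, pd_pd_comm (hYp 0 3) 1 2,
    pd_pd_comm (hYp 1 2) 0 3, pd_pd_comm (hYp 1 3) 0 2, pd_pd_comm (hYp 2 3) 0 1]
end
end

section
/- Let X^a be a Killing vector field of g (i.e. (£_Xg)_{ab} = 0). Then the Lie derivative along X commutes with the covariant derivative on (0,2)-tensors: for every smooth (0,2)-tensor field T_{ab} on U, (£_X(∇T))_{cab} = (∇(£_XT))_{cab}, where ∇T denotes the (0,3)-tensor field (c,a,b) ↦ ∇_cT_{ab} and the Lie derivative of a (0,3)-tensor S is (£_XS)_{cab} = X^m∂_mS_{cab} + S_{mab}∂_cX^m + S_{cmb}∂_aX^m + S_{cam}∂_bX^m. -/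
/-!
STATEMENT 7: If `X` is a Killing vector field of `g`, the Lie derivative along
`X` commutes with the covariant derivative on (0,2)-tensors:
`(£_X(∇T))_{cab} = (∇(£_XT))_{cab}` for every smooth (0,2)-tensor `T`.
-/

noncomputable section

/-- Lie derivative of a (0,2)-tensor field along the vector field `X`. -/
def lie2 (X : Fin 4 → Pt → ℝ) (T : Fin 4 → Fin 4 → Pt → ℝ)
    (a b : Fin 4) (p : Pt) : ℝ :=
  (∑ c, X c p * pd (T a b) c p) + (∑ c, T c b p * pd (X c) a p)
    + (∑ c, T a c p * pd (X c) b p)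

/-- Lie derivative of a (0,3)-tensor field along the vector field `X`. -/
def lie3 (X : Fin 4 → Pt → ℝ) (S : Fin 4 → Fin 4 → Fin 4 → Pt → ℝ)
    (c a b : Fin 4) (p : Pt) : ℝ :=
  (∑ m, X m p * pd (S c a b) m p) + (∑ m, S m a b p * pd (X m) c p)
    + (∑ m, S c m b p * pd (X m) a p) + (∑ m, S c a m p * pd (X m) b p)

section PartialDerivatives

variable {f h : Pt → ℝ} {p : Pt}

theorem ContDiffAt.pd (hf : ContDiffAt ℝ (⊤ : ℕ∞) f p) (c : Fin 4) :
    ContDiffAt ℝ (⊤ : ℕ∞) (pd f c) p :=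
  (hf.fderiv_right (m := (⊤ : ℕ∞)) (by simp)).clm_apply contDiffAt_const

theorem pd_add (hf : ContDiffAt ℝ (⊤ : ℕ∞) f p) (hh : ContDiffAt ℝ (⊤ : ℕ∞) h p) (c : Fin 4) :
    pd (fun q => f q + h q) c p = pd f c p + pd h c p := by
  simp [pd, fderiv_fun_add (hf.differentiableAt (by simp)) (hh.differentiableAt (by simp))]

theorem pd_sub (hf : ContDiffAt ℝ (⊤ : ℕ∞) f p) (hh : ContDiffAt ℝ (⊤ : ℕ∞) h p) (c : Fin 4) :
    pd (fun q => f q - h q) c p = pd f c p - pd h c p := by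
  simp [pd, fderiv_fun_sub (hf.differentiableAt (by simp)) (hh.differentiableAt (by simp))]

theorem pd_sum_mul {F H : Fin 4 → Pt → ℝ} (hF : ∀ m, ContDiffAt ℝ (⊤ : ℕ∞) (F m) p)
    (hH : ∀ m, ContDiffAt ℝ (⊤ : ℕ∞) (H m) p) (c : Fin 4) :
    pd (fun q => ∑ m, F m q * H m q) c p
      = ∑ m, (pd (F m) c p * H m p + F m p * pd (H m) c p) := by
  have hF' m := (hF m).differentiableAt (by simp)
  have hH' m := (hH m).differentiableAt (by simp)
  unfold pd
  rw [fderiv_fun_sum fun m _ => (hF' m).fun_mul (hH' m), sum_apply]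
  refine Finset.sum_congr rfl fun m _ => ?_
  rw [fderiv_fun_mul (hF' m) (hH' m)]
  simp
  ring

theorem pd_comm (hf : ContDiffAt ℝ (⊤ : ℕ∞) f p) (a b : Fin 4) :
    pd (pd f a) b p = pd (pd f b) a p := by
  have hd : DifferentiableAt ℝ (fderiv ℝ f) p :=
    (hf.fderiv_right (m := (⊤ : ℕ∞)) (by simp)).differentiableAt (by simp)
  have key (i j : Fin 4) : pd (pd f i) j p
      = fderiv ℝ (fderiv ℝ f) p (Pi.single j 1) (Pi.single i 1) := by
    change fderiv ℝ (fun q => fderiv ℝ f q (Pi.single i 1)) p (Pi.single j 1) = _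
    rw [fderiv_clm_apply hd (differentiableAt_const _)]
    simp
  rw [key, key]
  exact hf.isSymmSndFDerivAt (by simpa using WithTop.coe_le_coe.2 (le_top : (2 : ℕ∞) ≤ ⊤)) _ _

theorem pd_congr_of_eqOn {U : Set Pt} (hU : IsOpen U) (hp : p ∈ U) (hfh : ∀ q ∈ U, f q = h q)
    (c : Fin 4) : pd f c p = pd h c p := by
  have : f =ᶠ[nhds p] h := Filter.eventually_of_mem (hU.mem_nhds hp) hfh
  simp only [pd, this.fderiv_eq]

theorem pd_eq_zero_of_eqOn {U : Set Pt} (hU : IsOpen U) (hp : p ∈ U) (hf : ∀ q ∈ U, f q = 0)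
    (c : Fin 4) : pd f c p = 0 := by
  rw [pd_congr_of_eqOn (h := fun _ => 0) hU hp hf]
  simp [pd]

end PartialDerivatives

/-- Lie derivative `(£_X Γ)^m_{ab}` of the connection coefficients along the vector field `X`. -/
def lieConn (X : Fin 4 → Pt → ℝ) (Γ : Fin 4 → Fin 4 → Fin 4 → Pt → ℝ)
    (m a b : Fin 4) (p : Pt) : ℝ :=
  (∑ k, X k p * pd (Γ m a b) k p) - (∑ k, Γ k a b p * pd (X m) k p)
    + (∑ k, Γ m k b p * pd (X k) a p) + (∑ k, Γ m a k p * pd (X k) b p)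
    + pd (pd (X m) b) a p

section Commutator

variable {Γ : Fin 4 → Fin 4 → Fin 4 → Pt → ℝ} {X : Fin 4 → Pt → ℝ} {Y : Fin 4 → Fin 4 → Pt → ℝ}
  {p : Pt}

theorem pd_cov2 (hΓ : ∀ m a b, ContDiffAt ℝ (⊤ : ℕ∞) (Γ m a b) p)
    (hY : ∀ a b, ContDiffAt ℝ (⊤ : ℕ∞) (Y a b) p) (c a b k : Fin 4) :
    pd (cov2 Γ Y c a b) k p = pd (pd (Y a b) c) k p
      - ∑ m, (pd (Γ m c a) k p * Y m b p + Γ m c a p * pd (Y m b) k p)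
      - ∑ m, (pd (Γ m c b) k p * Y a m p + Γ m c b p * pd (Y a m) k p) := by
  have h₁ : ContDiffAt ℝ (⊤ : ℕ∞) (fun q => ∑ m, Γ m c a q * Y m b q) p :=
    ContDiffAt.sum fun m _ => (hΓ m c a).mul (hY m b)
  have h₂ : ContDiffAt ℝ (⊤ : ℕ∞) (fun q => ∑ m, Γ m c b q * Y a m q) p :=
    ContDiffAt.sum fun m _ => (hΓ m c b).mul (hY a m)
  unfold cov2
  rw [pd_sub (((hY a b).pd c).sub h₁) h₂, pd_sub ((hY a b).pd c) h₁,
    pd_sum_mul (fun m => hΓ m c a) (fun m => hY m b),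
    pd_sum_mul (fun m => hΓ m c b) (fun m => hY a m)]

theorem pd_lie2 (hX : ∀ a, ContDiffAt ℝ (⊤ : ℕ∞) (X a) p)
    (hY : ∀ a b, ContDiffAt ℝ (⊤ : ℕ∞) (Y a b) p) (a b c : Fin 4) :
    pd (lie2 X Y a b) c p
      = (∑ k, (pd (X k) c p * pd (Y a b) k p + X k p * pd (pd (Y a b) c) k p))
        + (∑ k, (pd (Y k b) c p * pd (X k) a p + Y k b p * pd (pd (X k) a) c p))
        + (∑ k, (pd (Y a k) c p * pd (X k) b p + Y a k p * pd (pd (X k) b) c p)) := by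
  have h₁ : ContDiffAt ℝ (⊤ : ℕ∞) (fun q => ∑ k, X k q * pd (Y a b) k q) p :=
    ContDiffAt.sum fun k _ => (hX k).mul ((hY a b).pd k)
  have h₂ : ContDiffAt ℝ (⊤ : ℕ∞) (fun q => ∑ k, Y k b q * pd (X k) a q) p :=
    ContDiffAt.sum fun k _ => (hY k b).mul ((hX k).pd a)
  have h₃ : ContDiffAt ℝ (⊤ : ℕ∞) (fun q => ∑ k, Y a k q * pd (X k) b q) p :=
    ContDiffAt.sum fun k _ => (hY a k).mul ((hX k).pd b)
  unfold lie2
  rw [pd_add (h₁.add h₂) h₃, pd_add h₁ h₂,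
    pd_sum_mul hX (fun k => (hY a b).pd k),
    pd_sum_mul (fun k => hY k b) (fun k => (hX k).pd a),
    pd_sum_mul (fun k => hY a k) (fun k => (hX k).pd b)]
  simp only [pd_comm (hY a b) _ c]

theorem lie3_cov2_sub_cov2_lie2 (hΓ : ∀ m a b, ContDiffAt ℝ (⊤ : ℕ∞) (Γ m a b) p)
    (hX : ∀ a, ContDiffAt ℝ (⊤ : ℕ∞) (X a) p)
    (hY : ∀ a b, ContDiffAt ℝ (⊤ : ℕ∞) (Y a b) p) (c a b : Fin 4) :
    lie3 X (cov2 Γ Y) c a b p - cov2 Γ (lie2 X Y) c a b p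
      = -(∑ m, lieConn X Γ m c a p * Y m b p) - ∑ m, lieConn X Γ m c b p * Y a m p := by
  rw [lie3, cov2, pd_lie2 hX hY]
  simp only [pd_cov2 hΓ hY]
  simp only [cov2, lie2, lieConn, Fin.sum_univ_four]
  ring

theorem lieConn_symm {U : Set Pt} (hU : IsOpen U)
    (hΓsymm : ∀ m a b, ∀ q ∈ U, Γ m a b q = Γ m b a q) (hp : p ∈ U)
    (hX : ∀ a, ContDiffAt ℝ (⊤ : ℕ∞) (X a) p) (m a b : Fin 4) :
    lieConn X Γ m a b p = lieConn X Γ m b a p := by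
  have h₁ k : pd (Γ m a b) k p = pd (Γ m b a) k p := pd_congr_of_eqOn hU hp (hΓsymm m a b) k
  have h₂ k : Γ k a b p = Γ k b a p := hΓsymm k a b p hp
  have h₃ k : Γ m k b p = Γ m b k p := hΓsymm m k b p hp
  have h₄ k : Γ m a k p = Γ m k a p := hΓsymm m a k p hp
  simp only [lieConn, h₁, h₂, h₃, h₄, pd_comm (hX m) b a]
  ring

end Commutator

theorem eq_zero_of_symm_of_antisymm {ι : Type*} {A : ι → ι → ι → ℝ}
    (hs : ∀ i j k, A i j k = A j i k) (ha : ∀ i j k, A i j k = -A i k j) (i j k : ι) :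
    A i j k = 0 := by
  linarith [ha i j k, hs i k j, ha k i j, hs k j i, ha j k i, hs j i k]

theorem lieConn_eq_zero_of_killing {U : Set Pt} (hU : IsOpen U)
    {Γ : Fin 4 → Fin 4 → Fin 4 → Pt → ℝ}
    (hΓsmooth : ∀ m a b, ContDiffOn ℝ (⊤ : ℕ∞) (Γ m a b) U)
    (hΓsymm : ∀ m a b, ∀ p ∈ U, Γ m a b p = Γ m b a p)
    {g : Fin 4 → Fin 4 → Pt → ℝ}
    (hgsmooth : ∀ a b, ContDiffOn ℝ (⊤ : ℕ∞) (g a b) U)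
    (hgsymm : ∀ a b, ∀ p ∈ U, g a b p = g b a p)
    (hgdet : ∀ p ∈ U, Matrix.det (Matrix.of fun i j => g i j p) ≠ 0)
    (hcompat : ∀ p ∈ U, ∀ c a b, cov2 Γ g c a b p = 0)
    {X : Fin 4 → Pt → ℝ}
    (hXsmooth : ∀ a, ContDiffOn ℝ (⊤ : ℕ∞) (X a) U)
    (hKilling : ∀ p ∈ U, ∀ a b, lie2 X g a b p = 0)
    {p : Pt} (hp : p ∈ U) (m a b : Fin 4) : lieConn X Γ m a b p = 0 := by
  have hUp := hU.mem_nhds hp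
  have hX a := (hXsmooth a).contDiffAt hUp
  have hlie (c a b) : lie3 X (cov2 Γ g) c a b p = 0 := by
    simp [lie3, hcompat p hp, pd_eq_zero_of_eqOn hU hp fun q hq => hcompat q hq _ _ _]
  have hcov (c a b) : cov2 Γ (lie2 X g) c a b p = 0 := by
    simp [cov2, hKilling p hp, pd_eq_zero_of_eqOn hU hp fun q hq => hKilling q hq _ _]
  have hlower : ∀ c a b, ∑ m, lieConn X Γ m c a p * g m b p = 0 := by
    refine eq_zero_of_symm_of_antisymm (fun c a b => ?_) (fun c a b => ?_)
    · simp only [lieConn_symm hU hΓsymm hp hX _ c a]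
    · have h := lie3_cov2_sub_cov2_lie2 (fun m a b => (hΓsmooth m a b).contDiffAt hUp) hX
        (fun a b => (hgsmooth a b).contDiffAt hUp) c a b
      simp only [hlie, hcov, hgsymm a _ p hp] at h
      linarith
  exact congrFun (Matrix.eq_zero_of_vecMul_eq_zero (hgdet p hp)
    (v := fun m => lieConn X Γ m a b p) (funext fun k => hlower a b k)) m

theorem lie_derivative_commutes_with_covariant_derivative
    (U : Set Pt) (hU : IsOpen U)
    (Γ : Fin 4 → Fin 4 → Fin 4 → Pt → ℝ)
    (hΓsmooth : ∀ m a b, ContDiffOn ℝ (⊤ : ℕ∞) (Γ m a b) U)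
    (hΓsymm : ∀ m a b, ∀ p ∈ U, Γ m a b p = Γ m b a p)
    (g : Fin 4 → Fin 4 → Pt → ℝ)
    (hgsmooth : ∀ a b, ContDiffOn ℝ (⊤ : ℕ∞) (g a b) U)
    (hgsymm : ∀ a b, ∀ p ∈ U, g a b p = g b a p)
    (hgdet : ∀ p ∈ U, Matrix.det (Matrix.of fun i j => g i j p) < 0)
    (hcompat : ∀ p ∈ U, ∀ c a b, cov2 Γ g c a b p = 0)
    (X : Fin 4 → Pt → ℝ)
    (hXsmooth : ∀ a, ContDiffOn ℝ (⊤ : ℕ∞) (X a) U)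
    (hKilling : ∀ p ∈ U, ∀ a b, lie2 X g a b p = 0)
    (T : Fin 4 → Fin 4 → Pt → ℝ)
    (hTsmooth : ∀ a b, ContDiffOn ℝ (⊤ : ℕ∞) (T a b) U) :
    ∀ p ∈ U, ∀ c a b,
      lie3 X (cov2 Γ T) c a b p = cov2 Γ (lie2 X T) c a b p := by
  intro p hp c a b
  have hUp := hU.mem_nhds hp
  have h := lie3_cov2_sub_cov2_lie2 (fun m a b => (hΓsmooth m a b).contDiffAt hUp)
    (fun a => (hXsmooth a).contDiffAt hUp) (fun a b => (hTsmooth a b).contDiffAt hUp) c a b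
  simp only [lieConn_eq_zero_of_killing hU hΓsmooth hΓsymm hgsmooth hgsymm
    (fun q hq => (hgdet q hq).ne) hcompat hXsmooth hKilling hp, zero_mul,
    Finset.sum_const_zero, neg_zero, sub_zero] at h
  exact sub_eq_zero.mp h
end
end

section
/- With G and K the contravariant tensors of the Benenti–Francaviglia form, the associated quadratic Hamiltonians 𝒢(q,p) := Σ_{a,b} G^{ab}(q) p_a p_b and 𝒦(q,p) := Σ_{a,b} K^{ab}(q) p_a p_b Poisson-commute on U × ℝ⁴: for all (q,p) ∈ U × ℝ⁴, Σ_{i=0}^{3} [ (∂𝒢/∂p_i)(q,p)·(∂𝒦/∂q^i)(q,p) − (∂𝒦/∂p_i)(q,p)·(∂𝒢/∂q^i)(q,p) ] = 0. -/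
/-!
STATEMENT 15: The quadratic Hamiltonians `𝒢(q,p) = G^{ab}(q)p_ap_b` and
`𝒦(q,p) = K^{ab}(q)p_ap_b` of the Benenti–Francaviglia tensors `G` and `K`
Poisson-commute on `U × ℝ⁴`.
-/

noncomputable section

/-- The contravariant metric `G` of the Benenti–Francaviglia form. -/
def BFG (A1 A2 A3 A4 A5 B1 B2 B3 B4 B5 : ℝ → ℝ) (q : Pt) :
    Matrix (Fin 4) (Fin 4) ℝ :=
  (A1 (q 0) + B1 (q 1))⁻¹ •
    Matrix.of ![![A2 (q 0), 0, 0, 0],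
      ![0, B2 (q 1), 0, 0],
      ![0, 0, A3 (q 0) + B3 (q 1), A4 (q 0) + B4 (q 1)],
      ![0, 0, A4 (q 0) + B4 (q 1), A5 (q 0) + B5 (q 1)]]

/-- The contravariant Killing tensor `K` of the Benenti–Francaviglia form. -/
def BFK (A1 A2 A3 A4 A5 B1 B2 B3 B4 B5 : ℝ → ℝ) (q : Pt) :
    Matrix (Fin 4) (Fin 4) ℝ :=
  (A1 (q 0) + B1 (q 1))⁻¹ •
    Matrix.of ![![A2 (q 0) * B1 (q 1), 0, 0, 0],
      ![0, -(B2 (q 1) * A1 (q 0)), 0, 0],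
      ![0, 0, B1 (q 1) * A3 (q 0) - A1 (q 0) * B3 (q 1),
        B1 (q 1) * A4 (q 0) - A1 (q 0) * B4 (q 1)],
      ![0, 0, B1 (q 1) * A4 (q 0) - A1 (q 0) * B4 (q 1),
        B1 (q 1) * A5 (q 0) - A1 (q 0) * B5 (q 1)]]

/-- The quadratic Hamiltonian associated with a contravariant tensor field. -/
def ham (T : Pt → Matrix (Fin 4) (Fin 4) ℝ) (q p : Pt) : ℝ :=
  ∑ a, ∑ b, T q a b * p a * p b

/-- Partial derivative of a phase-space function with respect to the momentum `p i`. -/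
def dP (F : Pt → Pt → ℝ) (i : Fin 4) (q p : Pt) : ℝ :=
  fderiv ℝ (fun p' => F q p') p (Pi.single i 1)

/-- Partial derivative of a phase-space function with respect to the coordinate `q i`. -/
def dQ (F : Pt → Pt → ℝ) (i : Fin 4) (q p : Pt) : ℝ :=
  fderiv ℝ (fun q' => F q' p) q (Pi.single i 1)

/-- The partial derivative in a coordinate of a function differentiable at `q` is the derivative
of its restriction to the coordinate line through `q`. -/
theorem fderiv_single_eq_of_hasDerivAt_update {f : Pt → ℝ} {q : Pt} {i : Fin 4} {d : ℝ}
    (hf : DifferentiableAt ℝ f q)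
    (hd : HasDerivAt (fun t => f (Function.update q i t)) d (q i)) :
    fderiv ℝ f q (Pi.single i 1) = d := by
  have hu : HasDerivAt (Function.update q i) (Pi.single i (1 : ℝ)) (q i) :=
    hasDerivAt_update q i (q i)
  have hf' : HasFDerivAt f (fderiv ℝ f q) (Function.update q i (q i)) := by
    rw [Function.update_eq_self]
    exact hf.hasFDerivAt
  exact (hf'.comp_hasDerivAt (q i) hu).unique hd

/-- The part of the numerator of the Hamiltonians that depends on a single coordinate, with `c`
the momentum conjugate to it and `u`, `v` the momenta of the ignorable coordinates. -/
def separatedPart (f₂ f₃ f₄ f₅ : ℝ → ℝ) (c u v t : ℝ) : ℝ :=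
  f₂ t * c ^ 2 + f₃ t * u ^ 2 + 2 * f₄ t * u * v + f₅ t * v ^ 2

theorem DifferentiableAt.separatedPart {f₂ f₃ f₄ f₅ : ℝ → ℝ} {t : ℝ}
    (h₂ : DifferentiableAt ℝ f₂ t) (h₃ : DifferentiableAt ℝ f₃ t)
    (h₄ : DifferentiableAt ℝ f₄ t) (h₅ : DifferentiableAt ℝ f₅ t) (c u v : ℝ) :
    DifferentiableAt ℝ (separatedPart f₂ f₃ f₄ f₅ c u v) t := by
  unfold _root_.separatedPart
  fun_prop

theorem ham_BFG (A1 A2 A3 A4 A5 B1 B2 B3 B4 B5 : ℝ → ℝ) (q p : Pt) :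
    ham (BFG A1 A2 A3 A4 A5 B1 B2 B3 B4 B5) q p =
      (separatedPart A2 A3 A4 A5 (p 0) (p 2) (p 3) (q 0)
        + separatedPart B2 B3 B4 B5 (p 1) (p 2) (p 3) (q 1)) / (A1 (q 0) + B1 (q 1)) := by
  simp [ham, BFG, separatedPart, Fin.sum_univ_four]
  ring

theorem ham_BFK (A1 A2 A3 A4 A5 B1 B2 B3 B4 B5 : ℝ → ℝ) (q p : Pt) :
    ham (BFK A1 A2 A3 A4 A5 B1 B2 B3 B4 B5) q p =
      (B1 (q 1) * separatedPart A2 A3 A4 A5 (p 0) (p 2) (p 3) (q 0)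
        - A1 (q 0) * separatedPart B2 B3 B4 B5 (p 1) (p 2) (p 3) (q 1))
        / (A1 (q 0) + B1 (q 1)) := by
  simp [ham, BFK, separatedPart, Fin.sum_univ_four]
  ring

theorem differentiable_ham (T : Pt → Matrix (Fin 4) (Fin 4) ℝ) (q : Pt) :
    Differentiable ℝ (fun p => ham T q p) := by
  unfold ham
  fun_prop

theorem dP_ham (T : Pt → Matrix (Fin 4) (Fin 4) ℝ) (i : Fin 4) (q p : Pt) :
    dP (ham T) i q p = ∑ a, (T q i a + T q a i) * p a := by
  refine fderiv_single_eq_of_hasDerivAt_update (differentiable_ham T q p) ?_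
  have hu (a : Fin 4) : HasDerivAt (fun t => Function.update p i t a)
      ((Pi.single i (1 : ℝ) : Pt) a) (p i) :=
    hasDerivAt_pi.1 (hasDerivAt_update p i (p i)) a
  have h := HasDerivAt.fun_sum (u := Finset.univ) fun a _ =>
    HasDerivAt.fun_sum (u := Finset.univ) fun b _ =>
      ((hu a).const_mul (T q a b)).fun_mul (hu b)
  refine h.congr_deriv ?_
  simp only [Function.update_eq_self, Finset.sum_add_distrib, add_mul]
  congr 1 <;> simp [Pi.single_apply, mul_ite, ite_mul]

theorem benenti_francaviglia_hamiltonians_poisson_commute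
    (I J : Set ℝ) (hIopen : IsOpen I) (hIint : Set.OrdConnected I)
    (hJopen : IsOpen J) (hJint : Set.OrdConnected J)
    (A1 A2 A3 A4 A5 B1 B2 B3 B4 B5 : ℝ → ℝ)
    (hA : ∀ f ∈ [A1, A2, A3, A4, A5], ContDiffOn ℝ (⊤ : ℕ∞) f I)
    (hB : ∀ f ∈ [B1, B2, B3, B4, B5], ContDiffOn ℝ (⊤ : ℕ∞) f J) :
    ∀ q p : Pt, q 0 ∈ I → q 1 ∈ J → A1 (q 0) + B1 (q 1) ≠ 0 →
      (∑ i : Fin 4,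
        (dP (ham (BFG A1 A2 A3 A4 A5 B1 B2 B3 B4 B5)) i q p
            * dQ (ham (BFK A1 A2 A3 A4 A5 B1 B2 B3 B4 B5)) i q p
          - dP (ham (BFK A1 A2 A3 A4 A5 B1 B2 B3 B4 B5)) i q p
            * dQ (ham (BFG A1 A2 A3 A4 A5 B1 B2 B3 B4 B5)) i q p)) = 0 := by
  intro q p hq0 hq1 hS
  have hdA : ∀ f ∈ [A1, A2, A3, A4, A5], DifferentiableAt ℝ f (q 0) := fun f hf =>
    ((hA f hf).contDiffAt (hIopen.mem_nhds hq0)).differentiableAt (by simp)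
  have hdB : ∀ f ∈ [B1, B2, B3, B4, B5], DifferentiableAt ℝ f (q 1) := fun f hf =>
    ((hB f hf).contDiffAt (hJopen.mem_nhds hq1)).differentiableAt (by simp)
  simp only [List.forall_mem_cons, List.not_mem_nil, false_imp_iff, implies_true,
    and_true] at hdA hdB
  obtain ⟨hA1, hA2, hA3, hA4, hA5⟩ := hdA
  obtain ⟨hB1, hB2, hB3, hB4, hB5⟩ := hdB
  have ha := hA2.separatedPart hA3 hA4 hA5 (p 0) (p 2) (p 3)
  have hb := hB2.separatedPart hB3 hB4 hB5 (p 1) (p 2) (p 3)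
  have hGd : DifferentiableAt ℝ
      (fun q' => ham (BFG A1 A2 A3 A4 A5 B1 B2 B3 B4 B5) q' p) q := by
    simp only [ham_BFG]
    fun_prop (disch := assumption)
  have hKd : DifferentiableAt ℝ
      (fun q' => ham (BFK A1 A2 A3 A4 A5 B1 B2 B3 B4 B5) q' p) q := by
    simp only [ham_BFK]
    fun_prop (disch := assumption)
  have hG0 := fderiv_single_eq_of_hasDerivAt_update (i := 0) hGd (by
    simp only [ham_BFG, Function.update_self, ne_eq, one_ne_zero, not_false_eq_true,
      Function.update_of_ne]
    exact (ha.hasDerivAt.add_const _).fun_div (hA1.hasDerivAt.add_const _) hS)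
  have hK0 := fderiv_single_eq_of_hasDerivAt_update (i := 0) hKd (by
    simp only [ham_BFK, Function.update_self, ne_eq, one_ne_zero, not_false_eq_true,
      Function.update_of_ne]
    exact ((ha.hasDerivAt.const_mul _).fun_sub (hA1.hasDerivAt.mul_const _)).fun_div
      (hA1.hasDerivAt.add_const _) hS)
  have hG1 := fderiv_single_eq_of_hasDerivAt_update (i := 1) hGd (by
    simp only [ham_BFG, Function.update_self, ne_eq, zero_ne_one, not_false_eq_true,
      Function.update_of_ne]
    exact (hb.hasDerivAt.const_add _).fun_div (hB1.hasDerivAt.const_add _) hS)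
  have hK1 := fderiv_single_eq_of_hasDerivAt_update (i := 1) hKd (by
    simp only [ham_BFK, Function.update_self, ne_eq, zero_ne_one, not_false_eq_true,
      Function.update_of_ne]
    exact ((hB1.hasDerivAt.mul_const _).fun_sub (hb.hasDerivAt.const_mul _)).fun_div
      (hB1.hasDerivAt.const_add _) hS)
  have hignorable (i : Fin 4) (h0 : 0 ≠ i) (h1 : 1 ≠ i) :
      dQ (ham (BFG A1 A2 A3 A4 A5 B1 B2 B3 B4 B5)) i q p = 0 ∧
        dQ (ham (BFK A1 A2 A3 A4 A5 B1 B2 B3 B4 B5)) i q p = 0 := by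
    constructor
    · refine fderiv_single_eq_of_hasDerivAt_update hGd ?_
      simpa only [ham_BFG, Function.update_of_ne h0, Function.update_of_ne h1] using
        hasDerivAt_const _ _
    · refine fderiv_single_eq_of_hasDerivAt_update hKd ?_
      simpa only [ham_BFK, Function.update_of_ne h0, Function.update_of_ne h1] using
        hasDerivAt_const _ _
  obtain ⟨hG2, hK2⟩ := hignorable 2 (by decide) (by decide)
  obtain ⟨hG3, hK3⟩ := hignorable 3 (by decide) (by decide)
  rw [Fin.sum_univ_four, hG2, hK2, hG3, hK3]
  simp only [dQ, hG0, hK0, hG1, hK1, dP_ham, Fin.sum_univ_four]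
  simp [BFG, BFK]
  generalize deriv (separatedPart A2 A3 A4 A5 (p 0) (p 2) (p 3)) (q 0) = a'
  generalize deriv (separatedPart B2 B3 B4 B5 (p 1) (p 2) (p 3)) (q 1) = b'
  field_simp
  ring
end
end

section
/- Fix real parameters M, a, Q, b, H, ε̃ and set Δ(r) = r² + a² − 2r(M−b) + ε̃Q² − H/r, ρ(r,x) = r² + a²x² + 2br, f(r) = r² + a² + 2br. At any point (r,x,φ,t) with r ≠ 0, Δ(r) > 0, ρ(r,x) > 0 and 1 − x² > 0, let g be the 4×4 covariant metric matrix, in the coordinate order (r,x,φ,t), of the line element (ω¹)² + (ω²)² + (ω³)² − (ω⁴)², where ω¹ = √(ρ/Δ)·dr, ω² = √(ρ/(1−x²))·dx, ω³ = √((1−x²)/ρ)·(a·dt − f·dφ), ω⁴ = √(Δ/ρ)·(dt − a(1−x²)·dφ). Then g is invertible and its inverse equals the Benenti–Francaviglia matrix G built from the allocations A₁(r) = r² + 2br, A₂(r) = Δ(r), A₃(r) = −a²/Δ(r), A₄(r) = −f(r)a/Δ(r), A₅(r) = −f(r)²/Δ(r), B₁(x) = a²x², B₂(x) = 1 − x²,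 B₃(x) = 1/(1−x²), B₄(x) = a, B₅(x) = a²(1−x²); i.e. G·g equals the 4×4 identity matrix (note A₁(r)+B₁(x) = ρ(r,x) ≠ 0). -/
/-!
STATEMENT 17: The 6-parameter black-hole family (Kerr, Kerr–Newman, modified
Kerr, Kerr–Sen) has covariant metric `g` (built from the coframe
`ω¹,ω²,ω³,ω⁴` and `η = diag(1,1,1,−1)`) whose inverse is the
Benenti–Francaviglia matrix `G` built from the allocations
`A₁ = r²+2br, A₂ = Δ, A₃ = −a²/Δ, A₄ = −fa/Δ, A₅ = −f²/Δ,
 B₁ = a²x², B₂ = 1−x², B₃ = 1/(1−x²), B₄ = a, B₅ = a²(1−x²)`.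
-/

noncomputable section

/-- The Benenti–Francaviglia contravariant matrix built from the allocations
`A₁,…,A₅` (values at `r`) and `B₁,…,B₅` (values at `x`). -/
def BFGmat (A1 A2 A3 A4 A5 B1 B2 B3 B4 B5 : ℝ) : Matrix (Fin 4) (Fin 4) ℝ :=
  (A1 + B1)⁻¹ •
    Matrix.of ![![A2, 0, 0, 0],
      ![0, B2, 0, 0],
      ![0, 0, A3 + B3, A4 + B4],
      ![0, 0, A4 + B4, A5 + B5]]

/-- `Δ(r) = r² + a² − 2r(M−b) + ε̃Q² − H/r`. -/
def Δf (M a Q b H εt r : ℝ) : ℝ := r ^ 2 + a ^ 2 - 2 * r * (M - b) + εt * Q ^ 2 - H / r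

/-- `ρ(r,x) = r² + a²x² + 2br`. -/
def ρf (a b r x : ℝ) : ℝ := r ^ 2 + a ^ 2 * x ^ 2 + 2 * b * r

/-- `f(r) = r² + a² + 2br`. -/
def ff (a b r : ℝ) : ℝ := r ^ 2 + a ^ 2 + 2 * b * r

/-- The coframe matrix: row `c` holds the components of `ω^{c+1}` in the
coordinates `(r,x,φ,t)`. -/
def coframe (M a Q b H εt r x : ℝ) : Matrix (Fin 4) (Fin 4) ℝ :=
  Matrix.of
    ![![Real.sqrt (ρf a b r x / Δf M a Q b H εt r), 0, 0, 0],
      ![0, Real.sqrt (ρf a b r x / (1 - x ^ 2)), 0, 0],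
      ![0, 0, -(ff a b r) * Real.sqrt ((1 - x ^ 2) / ρf a b r x),
        a * Real.sqrt ((1 - x ^ 2) / ρf a b r x)],
      ![0, 0, -(a * (1 - x ^ 2)) * Real.sqrt (Δf M a Q b H εt r / ρf a b r x),
        Real.sqrt (Δf M a Q b H εt r / ρf a b r x)]]

/-- The covariant metric `g_{ab} = Σ η_{cd} ω^c_a ω^d_b`, `η = diag(1,1,1,−1)`. -/
def gcov (M a Q b H εt r x : ℝ) : Matrix (Fin 4) (Fin 4) ℝ :=
  (coframe M a Q b H εt r x).transpose * Matrix.diagonal ![1, 1, 1, -1] * coframe M a Q b H εt r x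

/-- The covariant metric in closed form, with the square roots of the coframe eliminated. -/
theorem gcov_eq_smul {M a Q b H εt r x : ℝ} (hΔ : 0 < Δf M a Q b H εt r)
    (hρ : 0 < ρf a b r x) (hx : 0 < 1 - x ^ 2) :
    gcov M a Q b H εt r x = (ρf a b r x)⁻¹ • Matrix.of
      ![![ρf a b r x ^ 2 / Δf M a Q b H εt r, 0, 0, 0],
        ![0, ρf a b r x ^ 2 / (1 - x ^ 2), 0, 0],
        ![0, 0, ff a b r ^ 2 * (1 - x ^ 2) - (a * (1 - x ^ 2)) ^ 2 * Δf M a Q b H εt r,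
          a * (1 - x ^ 2) * (Δf M a Q b H εt r - ff a b r)],
        ![0, 0, a * (1 - x ^ 2) * (Δf M a Q b H εt r - ff a b r),
          a ^ 2 * (1 - x ^ 2) - Δf M a Q b H εt r]] := by
  have h1 := Real.sq_sqrt (div_pos hρ hΔ).le
  have h2 := Real.sq_sqrt (div_pos hρ hx).le
  have h3 := Real.sq_sqrt (div_pos hx hρ).le
  have h4 := Real.sq_sqrt (div_pos hΔ hρ).le
  unfold gcov coframe
  generalize Real.sqrt (ρf a b r x / Δf M a Q b H εt r) = s1 at *
  generalize Real.sqrt (ρf a b r x / (1 - x ^ 2)) = s2 at *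
  generalize Real.sqrt ((1 - x ^ 2) / ρf a b r x) = s3 at *
  generalize Real.sqrt (Δf M a Q b H εt r / ρf a b r x) = s4 at *
  generalize Δf M a Q b H εt r = D at *
  generalize ff a b r = f at *
  generalize ρf a b r x = p at *
  generalize 1 - x ^ 2 = y at *
  ext i j
  fin_cases i <;> fin_cases j <;>
    simp [Matrix.mul_apply, Fin.sum_univ_four, Matrix.diagonal_apply]
  · rw [← sq, h1]; field_simp
  · rw [← sq, h2]; field_simp
  · linear_combination f ^ 2 * h3 - (a * y) ^ 2 * h4
  · linear_combination -(f * a) * h3 + a * y * h4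
  · linear_combination -(f * a) * h3 + a * y * h4
  · linear_combination a ^ 2 * h3 - h4

theorem six_parameter_family_inverse_is_benenti_francaviglia
    (M a Q b H εt : ℝ) (r x φ t : ℝ)
    (hr : r ≠ 0)
    (hΔ : Δf M a Q b H εt r > 0)
    (hρ : ρf a b r x > 0)
    (hx : 1 - x ^ 2 > 0) :
    IsUnit (gcov M a Q b H εt r x) ∧
    (gcov M a Q b H εt r x)⁻¹ =
      BFGmat (r ^ 2 + 2 * b * r) (Δf M a Q b H εt r)
        (-(a ^ 2) / Δf M a Q b H εt r)
        (-(ff a b r * a) / Δf M a Q b H εt r)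
        (-(ff a b r ^ 2) / Δf M a Q b H εt r)
        (a ^ 2 * x ^ 2) (1 - x ^ 2) (1 / (1 - x ^ 2)) a (a ^ 2 * (1 - x ^ 2)) ∧
    BFGmat (r ^ 2 + 2 * b * r) (Δf M a Q b H εt r)
        (-(a ^ 2) / Δf M a Q b H εt r)
        (-(ff a b r * a) / Δf M a Q b H εt r)
        (-(ff a b r ^ 2) / Δf M a Q b H εt r)
        (a ^ 2 * x ^ 2) (1 - x ^ 2) (1 / (1 - x ^ 2)) a (a ^ 2 * (1 - x ^ 2))
      * gcov M a Q b H εt r x = 1 := by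
  have key : BFGmat (r ^ 2 + 2 * b * r) (Δf M a Q b H εt r)
        (-(a ^ 2) / Δf M a Q b H εt r)
        (-(ff a b r * a) / Δf M a Q b H εt r)
        (-(ff a b r ^ 2) / Δf M a Q b H εt r)
        (a ^ 2 * x ^ 2) (1 - x ^ 2) (1 / (1 - x ^ 2)) a (a ^ 2 * (1 - x ^ 2))
      * gcov M a Q b H εt r x = 1 := by
    have hρ_eq : r ^ 2 + 2 * b * r + a ^ 2 * x ^ 2 = ρf a b r x := by unfold ρf; ring
    have hff : ff a b r = ρf a b r x + a ^ 2 * (1 - x ^ 2) := by unfold ff ρf; ring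
    rw [gcov_eq_smul hΔ hρ hx, BFGmat, hρ_eq, hff]
    generalize Δf M a Q b H εt r = D at *
    generalize ρf a b r x = p at *
    generalize 1 - x ^ 2 = y at *
    have hD := hΔ.ne'
    have hp := hρ.ne'
    have hy := hx.ne'
    ext i j
    fin_cases i <;> fin_cases j <;>
      simp [Matrix.mul_apply, Fin.sum_univ_four] <;> field_simp <;> ring
  exact ⟨.of_mul_eq_one_right _ key, Matrix.inv_eq_left_inv key, key⟩
end
end
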